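/- Let n ≥ 4 and let a_3, …, a_{n−1} ∈ ℝ, with the convention a_m = 0 for m < 3 or m > n−1. For each 1 ≤ k ≤ n−3 define on the open set U = {x ∈ ℝ^{n−1} : x_1 > 0} the function χ_k(x) = Σ_{m=0}^{⌊(k+1)/2⌋} (−1)^m ((ln x_1)^m / m!) · [ Σ_{(i_1,…,i_m)} a_{i_1+3} a_{i_2+3} ⋯ a_{i_m+3} + Σ_{(j, i_1,…,i_m)} (ξ_{j+1}(x)/x_1^{j+2}) · a_{i_1+3} a_{i_2+3} ⋯ a_{i_m+3} ], where the first inner sum ranges over m-tuples of integers 0 ≤ i_1, …, i_m ≤ k+1 with i_1 + … + i_m = k−2m+1 and the second over tuples of integers 0 ≤ j, i_1, …, i_m ≤ k+1 with j + i_1 + … + i_m = k−2m−1. Then each χ_k satisfies the partial differential equation F_T χ_k = 0 on U, where F_T = x_1 ∂/∂x_1 + x_2 ∂/∂x_2 + Σ_{l=1}^{n−3} ( x_{l+2} + Σ_{j=1}^{l} a_{l+3−j} x_j ) ∂/∂x_{l+2}. (These are the n−3 generalized Casimir invariants of the solvable Lie algebra s_{n+1,6}(a_3, …, a_{n−1}).)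 -/

import Mathlib

open MvPolynomial in
/-- The polynomial invariants `ξ_k` of the coadjoint representation of `n_{n,1}`:
`ξ_0 = x 1` and, for `k ≥ 1`,
`ξ_k = ((-1)^k k/(k+1)!) x_2^{k+1} + Σ_{j=0}^{k-1} ((-1)^j/j!) x_2^j x_{k+2-j} x_1^{k-j}`. -/
noncomputable def xi (F : Type*) [Field F] : ℕ → MvPolynomial ℕ F
  | 0 => X 1
  | k + 1 =>
      C ((-1 : F) ^ (k + 1) * ((k + 1 : ℕ) : F) / (((k + 2).factorial : ℕ) : F)) *
          X 2 ^ (k + 2) +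
        ∑ j ∈ Finset.range (k + 1),
          C ((-1 : F) ^ j / ((j.factorial : ℕ) : F)) * X 2 ^ j *
            X (k + 3 - j) * X 1 ^ (k + 1 - j)

/-- The `1`-based coordinates of a point `x ∈ ℝ^{n-1}`: `coords n x i = x_i` for
`1 ≤ i ≤ n-1` and `0` otherwise. -/
noncomputable def coords (n : ℕ) (x : Fin (n - 1) → ℝ) : ℕ → ℝ :=
  fun i => if h : 1 ≤ i ∧ i ≤ n - 1 then x ⟨i - 1, by omega⟩ else 0

/-- The `j`-th coordinate unit vector of `ℝ^{n-1}` (`1`-based). -/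
noncomputable def unitv (n : ℕ) (j : ℕ) : Fin (n - 1) → ℝ :=
  fun i => if i.val + 1 = j then 1 else 0

/-- The generalized Casimir invariants of `s_{n+1,6}(a_3, …, a_{n-1})`:
`χ_k(x) = Σ_{m=0}^{⌊(k+1)/2⌋} (-1)^m (ln x_1)^m/m! ·
  [ Σ_{i_1+…+i_m = k-2m+1} a_{i_1+3}⋯a_{i_m+3}
    + Σ_{j+i_1+…+i_m = k-2m-1} (ξ_{j+1}(x)/x_1^{j+2}) a_{i_1+3}⋯a_{i_m+3} ]`,
the summation indices ranging over `0 ≤ j, i_1, …, i_m ≤ k+1` (the index-sum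
conditions being equations of integers). -/
noncomputable def chiS6 (n : ℕ) (a : ℕ → ℝ) (k : ℕ) (x : Fin (n - 1) → ℝ) : ℝ :=
  ∑ m ∈ Finset.range ((k + 1) / 2 + 1),
    (-1 : ℝ) ^ m * (Real.log (coords n x 1)) ^ m / (m.factorial : ℝ) *
      ((∑ i ∈ Finset.filter
            (fun i : Fin m → ℕ => (∑ t, (i t : ℤ)) = (k : ℤ) - 2 * m + 1)
            (Fintype.piFinset fun _ : Fin m => Finset.range (k + 2)),
          ∏ t, a (i t + 3)) +
       (∑ j ∈ Finset.range (k + 2),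
          ∑ i ∈ Finset.filter
            (fun i : Fin m → ℕ => (j : ℤ) + (∑ t, (i t : ℤ)) = (k : ℤ) - 2 * m - 1)
            (Fintype.piFinset fun _ : Fin m => Finset.range (k + 2)),
          MvPolynomial.eval (coords n x) (xi ℝ (j + 1)) / (coords n x 1) ^ (j + 2) *
            ∏ t, a (i t + 3)))

open PowerSeries in
/-- The coefficients of a power of a power series as a sum over boxed tuples of exponents. -/
lemma sum_tuples_eq_coeff_pow (f : ℕ → ℝ) (m R : ℕ) (N : ℤ) (hN : N < R) :
    ∑ i ∈ Finset.filter (fun i : Fin m → ℕ => (∑ t, (i t : ℤ)) = N)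
        (Fintype.piFinset fun _ : Fin m => Finset.range R), ∏ t, f (i t) =
      if 0 ≤ N then coeff N.toNat (mk f ^ m) else 0 := by
  split_ifs with h
  · lift N to ℕ using h
    have hpow : (mk f ^ m : PowerSeries ℝ) = ∏ _t : Fin m, mk f := by simp
    rw [hpow, coeff_prod]
    refine Finset.sum_bij' (fun i _ => Finsupp.equivFunOnFinite.symm i) (fun l _ => ⇑l) ?_ ?_ ?_ ?_ ?_
    · intro i hi
      simp only [Finset.mem_filter] at hi
      simp only [Finset.mem_finsuppAntidiag, Int.toNat_natCast]
      exact ⟨by simpa using (by exact_mod_cast hi.2 : ∑ t, i t = N), Finset.subset_univ _⟩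
    · intro l hl
      simp only [Finset.mem_finsuppAntidiag, Int.toNat_natCast] at hl
      simp only [Finset.mem_filter, Fintype.mem_piFinset, Finset.mem_range]
      refine ⟨fun t => ?_, by exact_mod_cast hl.1⟩
      have := Finset.single_le_sum (f := fun t => l t) (fun _ _ => Nat.zero_le _)
        (Finset.mem_univ t)
      have hl1 : ∑ t, l t = N := hl.1
      omega
    · intro i _; rfl
    · intro l _; ext; rfl
    · intro i _; simp
  · refine Finset.sum_eq_zero fun i hi => ?_
    have h2 := (Finset.mem_filter.1 hi).2
    have : (0 : ℤ) ≤ ∑ t, (i t : ℤ) := Finset.sum_nonneg fun _ _ => by positivity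
    omega

/-- The generating series `exp (-(x_2 / x_1) z) * ∑ i, (x_{i+1} / x_1) z ^ i` of the rational
invariants `ξ_k / x_1 ^ (k + 1)`. -/
noncomputable def xiSeries (c : ℕ → ℝ) : PowerSeries ℝ :=
  PowerSeries.mk (fun j => (-(c 2 / c 1)) ^ j / (j.factorial : ℝ)) *
    PowerSeries.mk (fun i => c (i + 1) / c 1)

open PowerSeries in
lemma eval_xi_div_pow (c : ℕ → ℝ) (hc : c 1 ≠ 0) (j : ℕ) :
    MvPolynomial.eval c (xi ℝ (j + 1)) / c 1 ^ (j + 2) = coeff (j + 2) (xiSeries c) := by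
  rw [xiSeries, coeff_mul]
  simp only [coeff_mk]
  rw [Finset.Nat.sum_antidiagonal_eq_sum_range_succ
    (fun p q => (-(c 2 / c 1)) ^ p / (p.factorial : ℝ) * (c (q + 1) / c 1))]
  rw [Finset.sum_range_succ, Finset.sum_range_succ]
  simp only [xi, map_add, map_sum, map_mul, map_pow, MvPolynomial.eval_C, MvPolynomial.eval_X]
  rw [add_div, Finset.sum_div, add_comm, add_assoc]
  congr 1
  · refine Finset.sum_congr rfl fun i hi => ?_
    have hi' := Finset.mem_range.1 hi
    obtain ⟨d, rfl⟩ : ∃ d, j = i + d := ⟨j - i, by omega⟩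
    rw [show i + d + 3 - i = d + 3 by omega, show i + d + 1 - i = d + 1 by omega,
      show i + d + 2 - i + 1 = d + 3 by omega, neg_pow (c 2 / c 1), div_pow (c 2)]
    have := Nat.cast_ne_zero (R := ℝ).2 i.factorial_ne_zero
    field_simp
    ring
  · rw [show j + 2 - (j + 1) + 1 = 2 by omega, show j.succ.succ - (j + 2) + 1 = 1 by omega,
      neg_pow (c 2 / c 1), neg_pow (c 2 / c 1), div_pow (c 2), div_pow (c 2), Nat.factorial_succ (j + 1)]
    have := Nat.cast_ne_zero (R := ℝ).2 (j + 1).factorial_ne_zero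
    push_cast
    have : (j : ℝ) + 1 + 1 ≠ 0 := by positivity
    field_simp
    ring

open PowerSeries in
lemma xiSeries_eq (c : ℕ → ℝ) (hc : c 1 ≠ 0) :
    xiSeries c = 1 + X ^ 2 *
      mk (fun j => MvPolynomial.eval c (xi ℝ (j + 1)) / c 1 ^ (j + 2)) := by
  ext i
  match i with
  | 0 => simp [xiSeries, hc, coeff_mul]
  | 1 =>
    have h : Finset.HasAntidiagonal.antidiagonal 1 = {((0 : ℕ), (1 : ℕ)), (1, 0)} := rfl
    rw [map_add, show coeff 1 (1 : PowerSeries ℝ) = 0 by simp [coeff_one],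
      coeff_X_pow_mul', xiSeries, coeff_mul, h]
    simp [hc]
  | i + 2 =>
    rw [map_add, coeff_X_pow_mul, coeff_mk, eval_xi_div_pow c hc, coeff_one]
    simp

open PowerSeries in
/-- `χ_k` is the coefficient of `z ^ (k + 1)` in `exp (-(ln x_1) z² A(z)) P(z)`, where
`A(z) = ∑ a_{i+3} z ^ i` and `P` is the generating series `xiSeries`. -/
lemma chiS6_eq (n : ℕ) (a : ℕ → ℝ) (k : ℕ) (x : Fin (n - 1) → ℝ) (hx : coords n x 1 ≠ 0) :
    chiS6 n a k x = ∑ m ∈ Finset.range ((k + 1) / 2 + 1),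
      (-1 : ℝ) ^ m * (Real.log (coords n x 1)) ^ m / (m.factorial : ℝ) *
        coeff (k + 1) ((X ^ 2 * mk fun i => a (i + 3)) ^ m * xiSeries (coords n x)) := by
  refine Finset.sum_congr rfl fun m hm => ?_
  congr 1
  have hm' : 2 * m ≤ k + 1 := by have := Finset.mem_range.1 hm; omega
  set A : PowerSeries ℝ := mk fun i => a (i + 3) with hA
  set η : ℕ → ℝ := fun j =>
    MvPolynomial.eval (coords n x) (xi ℝ (j + 1)) / coords n x 1 ^ (j + 2) with hη
  obtain ⟨N, hN⟩ : ∃ N, k + 1 = N + 2 * m := ⟨k + 1 - 2 * m, by omega⟩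
  rw [xiSeries_eq _ hx, mul_pow, ← pow_mul, mul_assoc, hN, coeff_X_pow_mul, mul_add, mul_one,
    map_add]
  congr 1
  · rw [sum_tuples_eq_coeff_pow (fun i => a (i + 3)) m (k + 2) _ (by push_cast; omega),
      if_pos (by omega), show ((k : ℤ) - 2 * m + 1).toNat = N by omega]
  · have hT : ∀ j ∈ Finset.range (k + 2), (∑ i ∈ Finset.filter
            (fun i : Fin m → ℕ => (j : ℤ) + (∑ t, (i t : ℤ)) = (k : ℤ) - 2 * m - 1)
            (Fintype.piFinset fun _ : Fin m => Finset.range (k + 2)),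
          η j * ∏ t, a (i t + 3)) =
        if j + 2 ≤ N then η j * coeff (N - 2 - j) (A ^ m) else 0 := by
      intro j _
      rw [← Finset.mul_sum]
      have := sum_tuples_eq_coeff_pow (fun i => a (i + 3)) m (k + 2) ((k : ℤ) - 2 * m - 1 - j)
        (by push_cast; omega)
      rw [Finset.filter_congr (q := fun i : Fin m → ℕ =>
        (∑ t, (i t : ℤ)) = (k : ℤ) - 2 * m - 1 - j) (fun i _ => by constructor <;> intro <;> omega),
        this]
      by_cases h : j + 2 ≤ N
      · rw [if_pos (by omega), if_pos h,
          show ((k : ℤ) - 2 * m - 1 - j).toNat = N - 2 - j by omega]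
      · rw [if_neg (by omega), if_neg h, mul_zero]
    rw [Finset.sum_congr rfl hT, mul_left_comm, coeff_X_pow_mul', mul_comm, coeff_mul]
    split_ifs with h2
    · simp only [coeff_mk]
      rw [Finset.Nat.sum_antidiagonal_eq_sum_range_succ
        (fun p q => η p * coeff q (A ^ m)), ← Finset.sum_filter]
      refine Finset.sum_congr ?_ fun _ _ => rfl
      ext j
      simp only [Finset.mem_filter, Finset.mem_range]
      omega
    · exact Finset.sum_eq_zero fun j _ => if_neg (by omega)

lemma differentiable_coords (n i : ℕ) : Differentiable ℝ fun x => coords n x i := by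
  unfold coords
  split_ifs <;> fun_prop

lemma differentiable_eval_coords (n : ℕ) (p : MvPolynomial ℕ ℝ) :
    Differentiable ℝ fun x => MvPolynomial.eval (coords n x) p := by
  induction p using MvPolynomial.induction_on with
  | C r => simp
  | add p q hp hq => simpa using hp.fun_add hq
  | mul_X p i hp => simpa using hp.fun_mul (differentiable_coords n i)

lemma differentiableAt_chiS6 (n : ℕ) (a : ℕ → ℝ) (k : ℕ) (x : Fin (n - 1) → ℝ)
    (hx : coords n x 1 ≠ 0) : DifferentiableAt ℝ (chiS6 n a k) x := by
  have hc := (differentiable_coords n 1).differentiableAt (x := x)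
  unfold chiS6
  refine DifferentiableAt.fun_sum fun m _ => ?_
  have hlog : DifferentiableAt ℝ (fun y => (-1 : ℝ) ^ m * Real.log (coords n y 1) ^ m /
      (m.factorial : ℝ)) x := by fun_prop (disch := exact hx)
  refine hlog.fun_mul ?_
  refine (differentiableAt_const _).add ?_
  refine DifferentiableAt.fun_sum fun j _ => DifferentiableAt.fun_sum fun i _ => ?_
  have hxi := (differentiable_eval_coords n (xi ℝ (j + 1))).differentiableAt (x := x)
  fun_prop (disch := exact pow_ne_zero _ hx)

lemma coords_add_smul (n : ℕ) (x v : Fin (n - 1) → ℝ) (t : ℝ) (i : ℕ) :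
    coords n (x + t • v) i = coords n x i + t * coords n v i := by
  unfold coords
  split_ifs <;> simp

/-- The value at `x` of the vector field `F_T` of `s_{n+1,6}(a_3, …, a_{n-1})`. -/
noncomputable def fieldS6 (n : ℕ) (a : ℕ → ℝ) (x : Fin (n - 1) → ℝ) : Fin (n - 1) → ℝ :=
  fun i => coords n x (i + 1) +
    ∑ j ∈ Finset.Icc 1 (i.val - 1), a (i.val - 1 + 3 - j) * coords n x j

lemma coords_fieldS6_one (n : ℕ) (hn : 2 ≤ n) (a : ℕ → ℝ) (x : Fin (n - 1) → ℝ) :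
    coords n (fieldS6 n a x) 1 = coords n x 1 := by
  rw [coords, dif_pos (by omega)]
  simp [fieldS6]

lemma sum_smul_unitv (n : ℕ) (hn : 4 ≤ n) (a : ℕ → ℝ) (x : Fin (n - 1) → ℝ) :
    coords n x 1 • unitv n 1 + coords n x 2 • unitv n 2 +
      ∑ l ∈ Finset.Icc 1 (n - 3),
        (coords n x (l + 2) + ∑ j ∈ Finset.Icc 1 l, a (l + 3 - j) * coords n x j) •
          unitv n (l + 2) = fieldS6 n a x := by
  ext ⟨i, hi⟩
  simp only [Pi.add_apply, Pi.smul_apply, Finset.sum_apply, unitv, smul_eq_mul, mul_ite, mul_one,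
    mul_zero, fieldS6]
  match i with
  | 0 => simp
  | 1 => simp
  | i + 2 =>
    rw [Finset.sum_eq_single (i + 1)]
    · simp
    · intro l _ hl
      exact if_neg (by omega)
    · intro h
      exact absurd (Finset.mem_Icc.2 ⟨by omega, by omega⟩) h

open PowerSeries in
/-- Along the line through `x` in the direction of the vector field, the ratios `x_{i+1} / x_1`
move affinely in `t / (1 + t)`. -/
lemma coords_line_div (n : ℕ) (a : ℕ → ℝ) (x : Fin (n - 1) → ℝ) (hx : coords n x 1 ≠ 0)
    (t : ℝ) (ht : 1 + t ≠ 0) (i : ℕ) (hi : i + 2 ≤ n) :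
    (coords n x (i + 1) + t * coords n (fieldS6 n a x) (i + 1)) / (coords n x 1 * (1 + t)) =
      coords n x (i + 1) / coords n x 1 + t / (1 + t) *
        coeff i ((X ^ 2 * mk fun i => a (i + 3)) * mk fun i => coords n x (i + 1) / coords n x 1) := by
  have hv : coords n (fieldS6 n a x) (i + 1) = coords n x (i + 1) + coords n x 1 *
      coeff i ((X ^ 2 * mk fun i => a (i + 3)) *
        mk fun i => coords n x (i + 1) / coords n x 1) := by
    rw [coords, dif_pos (by omega)]
    simp only [fieldS6, Nat.add_sub_cancel]
    congr 1
    rw [mul_assoc, coeff_X_pow_mul']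
    match i with
    | 0 => simp
    | 1 => simp
    | i + 2 =>
      rw [if_pos (by omega), Nat.add_sub_cancel, mul_comm (mk _), coeff_mul]
      simp only [coeff_mk]
      rw [Finset.Nat.sum_antidiagonal_eq_sum_range_succ
        (fun p q => coords n x (p + 1) / coords n x 1 * a (q + 3)), Finset.mul_sum]
      refine Finset.sum_nbij' (fun j => j - 1) (fun j => j + 1) ?_ ?_ ?_ ?_ ?_
      · simp only [Finset.mem_Icc, Finset.mem_range]; omega
      · simp only [Finset.mem_Icc, Finset.mem_range]; omega
      · simp only [Finset.mem_Icc]; omega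
      · simp
      · intro j hj
        obtain ⟨h1, h2⟩ := Finset.mem_Icc.1 hj
        rw [Nat.sub_add_cancel h1, show i + 2 - 1 + 3 - j = i - (j - 1) + 3 by omega]
        field_simp
  rw [hv]
  field_simp
  ring

open PowerSeries in
lemma coeff_xiSeries_line (n : ℕ) (a : ℕ → ℝ) (x : Fin (n - 1) → ℝ) (hx : coords n x 1 ≠ 0)
    (t : ℝ) (ht : 1 + t ≠ 0) (i : ℕ) (hi : i + 2 ≤ n) :
    coeff i (xiSeries (coords n (x + t • fieldS6 n a x))) =
      coeff i (xiSeries (coords n x)) + t / (1 + t) *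
        coeff i ((X ^ 2 * mk fun i => a (i + 3)) * xiSeries (coords n x)) := by
  have h1 : coords n (x + t • fieldS6 n a x) 1 = coords n x 1 * (1 + t) := by
    rw [coords_add_smul, coords_fieldS6_one n (by omega)]
    ring
  have hu : ∀ j ≤ i, coords n (x + t • fieldS6 n a x) (j + 1) /
      coords n (x + t • fieldS6 n a x) 1 = coords n x (j + 1) / coords n x 1 + t / (1 + t) *
        coeff j ((X ^ 2 * mk fun i => a (i + 3)) *
          mk fun i => coords n x (i + 1) / coords n x 1) := by
    intro j hj
    rw [h1, coords_add_smul, coords_line_div n a x hx t ht j (by omega)]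
  have hy : i = 0 ∨ coords n (x + t • fieldS6 n a x) 2 / coords n (x + t • fieldS6 n a x) 1 =
      coords n x 2 / coords n x 1 := by
    rcases Nat.eq_zero_or_pos i with h | h
    · exact Or.inl h
    · right
      have := hu 1 h
      rwa [mul_assoc, coeff_X_pow_mul', if_neg (by norm_num), mul_zero, add_zero] at this
  have hE : ∀ j ≤ i, (-(coords n (x + t • fieldS6 n a x) 2 /
      coords n (x + t • fieldS6 n a x) 1)) ^ j = (-(coords n x 2 / coords n x 1)) ^ j := by
    intro j hj
    rcases hy with rfl | h
    · simp [Nat.le_zero.1 hj]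
    · rw [h]
  rw [xiSeries, xiSeries, mul_left_comm, coeff_mul, coeff_mul, coeff_mul, Finset.mul_sum,
    ← Finset.sum_add_distrib]
  refine Finset.sum_congr rfl fun p hp => ?_
  have hp' := Finset.HasAntidiagonal.mem_antidiagonal.1 hp
  rw [coeff_mk, coeff_mk, coeff_mk, coeff_mk, hE p.1 (by omega), hu p.2 (by omega)]
  ring

open PowerSeries in
lemma coeff_mul_xiSeries_line (n : ℕ) (a : ℕ → ℝ) (x : Fin (n - 1) → ℝ)
    (hx : coords n x 1 ≠ 0) (t : ℝ) (ht : 1 + t ≠ 0) (i : ℕ) (hi : i + 2 ≤ n) (m : ℕ) :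
    coeff i ((X ^ 2 * mk fun i => a (i + 3)) ^ m *
        xiSeries (coords n (x + t • fieldS6 n a x))) =
      coeff i ((X ^ 2 * mk fun i => a (i + 3)) ^ m * xiSeries (coords n x)) + t / (1 + t) *
        coeff i ((X ^ 2 * mk fun i => a (i + 3)) ^ (m + 1) * xiSeries (coords n x)) := by
  rw [pow_succ (X ^ 2 * mk _) m, mul_assoc (_ ^ m), coeff_mul, coeff_mul, coeff_mul, Finset.mul_sum,
    ← Finset.sum_add_distrib]
  refine Finset.sum_congr rfl fun p hp => ?_
  have hp' := Finset.HasAntidiagonal.mem_antidiagonal.1 hp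
  rw [coeff_xiSeries_line n a x hx t ht p.2 (by omega)]
  ring

lemma hasDerivAt_exp_truncation (L : ℝ) (D : ℕ → ℝ) (M : ℕ) :
    HasDerivAt (fun t : ℝ => ∑ m ∈ Finset.range (M + 1),
        (-1 : ℝ) ^ m * (L + Real.log (1 + t)) ^ m / (m.factorial : ℝ) *
          (D m + t / (1 + t) * D (m + 1)))
      ((-1) ^ M * L ^ M / (M.factorial : ℝ) * D (M + 1)) 0 := by
  have hid : HasDerivAt (fun t : ℝ => 1 + t) 1 0 := (hasDerivAt_id' (0 : ℝ)).const_add 1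
  have hlog : HasDerivAt (fun t : ℝ => L + Real.log (1 + t)) 1 0 := by
    simpa using (hid.log (by norm_num)).const_add L
  have hs : HasDerivAt (fun t : ℝ => t / (1 + t)) 1 0 := by
    simpa using (hasDerivAt_id' (0 : ℝ)).fun_div hid (by norm_num)
  have hterm : ∀ m : ℕ, HasDerivAt (fun t : ℝ =>
      (-1 : ℝ) ^ m * (L + Real.log (1 + t)) ^ m / (m.factorial : ℝ) *
        (D m + t / (1 + t) * D (m + 1)))
      ((-1) ^ m * (m * L ^ (m - 1)) / (m.factorial : ℝ) * D m +
        (-1) ^ m * L ^ m / (m.factorial : ℝ) * D (m + 1)) 0 := by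
    intro m
    have := (((hlog.fun_pow m).const_mul ((-1 : ℝ) ^ m)).div_const (m.factorial : ℝ)).fun_mul
      ((hs.mul_const (D (m + 1))).const_add (D m))
    simpa using this
  induction M with
  | zero => simpa using hterm 0
  | succ M ih =>
    simp only [Finset.sum_range_succ _ (M + 1)]
    refine (ih.fun_add (hterm (M + 1))).congr_deriv ?_
    rw [Nat.factorial_succ, Nat.add_sub_cancel]
    have := Nat.cast_ne_zero (R := ℝ).2 M.factorial_ne_zero
    push_cast
    have : (M : ℝ) + 1 ≠ 0 := by positivity
    field_simp
    ring

/-- For `n ≥ 4`, coefficients `a_3, …, a_{n-1} ∈ ℝ` (with `a_m = 0`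
for `m < 3` or `m > n-1`) and `1 ≤ k ≤ n-3`, the function `χ_k` above satisfies
`F_T χ_k = 0` on `{x : x_1 > 0}`, where
`F_T = x_1 ∂_1 + x_2 ∂_2 + Σ_{l=1}^{n-3} (x_{l+2} + Σ_{j=1}^{l} a_{l+3-j} x_j) ∂_{l+2}`:
these are the generalized Casimir invariants of `s_{n+1,6}(a_3, …, a_{n-1})`. -/
theorem chiS6_invariant (n : ℕ) (hn : 4 ≤ n) (a : ℕ → ℝ)
    (ha : ∀ m : ℕ, m < 3 ∨ n - 1 < m → a m = 0)
    (k : ℕ) (hk1 : 1 ≤ k) (hk2 : k ≤ n - 3)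
    (x : Fin (n - 1) → ℝ) (hx : 0 < coords n x 1) :
    DifferentiableAt ℝ (chiS6 n a k) x ∧
    coords n x 1 * fderiv ℝ (chiS6 n a k) x (unitv n 1) +
    coords n x 2 * fderiv ℝ (chiS6 n a k) x (unitv n 2) +
    ∑ l ∈ Finset.Icc 1 (n - 3),
      (coords n x (l + 2) + ∑ j ∈ Finset.Icc 1 l, a (l + 3 - j) * coords n x j) *
        fderiv ℝ (chiS6 n a k) x (unitv n (l + 2)) = 0 := by
  have hx0 := hx.ne'
  have hd := differentiableAt_chiS6 n a k x hx0
  refine ⟨hd, ?_⟩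
  have hsum : coords n x 1 * fderiv ℝ (chiS6 n a k) x (unitv n 1) +
      coords n x 2 * fderiv ℝ (chiS6 n a k) x (unitv n 2) +
      ∑ l ∈ Finset.Icc 1 (n - 3),
        (coords n x (l + 2) + ∑ j ∈ Finset.Icc 1 l, a (l + 3 - j) * coords n x j) *
          fderiv ℝ (chiS6 n a k) x (unitv n (l + 2)) =
      fderiv ℝ (chiS6 n a k) x (fieldS6 n a x) := by
    rw [← sum_smul_unitv n hn a x]
    simp only [map_add, map_smul, map_sum, smul_eq_mul]
  rw [hsum]
  have hline := hd.hasFDerivAt.hasLineDerivAt (fieldS6 n a x)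
  have hexp := hasDerivAt_exp_truncation (Real.log (coords n x 1))
    (fun m => PowerSeries.coeff (k + 1)
      ((PowerSeries.X ^ 2 * PowerSeries.mk fun i => a (i + 3)) ^ m * xiSeries (coords n x)))
    ((k + 1) / 2)
  have htop : PowerSeries.coeff (k + 1)
      ((PowerSeries.X ^ 2 * PowerSeries.mk fun i => a (i + 3)) ^ ((k + 1) / 2 + 1) *
        xiSeries (coords n x)) = 0 := by
    rw [mul_pow, ← pow_mul, mul_assoc, PowerSeries.coeff_X_pow_mul', if_neg (by omega)]
  simp only [htop, mul_zero] at hexp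
  refine hline.unique (hexp.congr_of_eventuallyEq ?_)
  filter_upwards [lt_mem_nhds (show (-1 : ℝ) < 0 by norm_num)] with t ht
  have ht' : 1 + t ≠ 0 := by linarith
  have h1 : coords n (x + t • fieldS6 n a x) 1 = coords n x 1 * (1 + t) := by
    rw [coords_add_smul, coords_fieldS6_one n (by omega)]
    ring
  rw [chiS6_eq _ _ _ _ (by rw [h1]; exact mul_ne_zero hx0 ht')]
  refine Finset.sum_congr rfl fun m _ => ?_
  rw [coeff_mul_xiSeries_line n a x hx0 t ht' (k + 1) (by omega) m, h1, Real.log_mul hx0 ht']
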